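/- arXiv:1910.00585 — 2 statements merged into one kernel-verified Lean document; each statement's English description precedes it below -/
import Mathlib

section
/- Fix N ≥ 1 and let Ω = {0,1}^N. A function f : Ω → [0,∞] satisfies ∫ f dP ≤ 1 for every exchangeable probability measure P on Ω if and only if for every k ∈ {0,…,N}, binom(N,k)^{−1} · Σ_{ω∈Ω : +ω = k} f(ω) ≤ 1, where +ω denotes the number of 1s in ω and binom(N,k) is the binomial coefficient. -/
open MeasureTheory
open scoped ENNReal

/-- `cnt ω` is the number of 1s (`true`s) in the binary sequence `ω`. -/
def cnt {N : ℕ} (ω : Fin N → Bool) : ℕ := (Finset.univ.filter fun i => ω i = true).card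

lemma card_filter_cnt_eq (N k : ℕ) :
    (Finset.univ.filter (fun ω : Fin N → Bool => cnt ω = k)).card = N.choose k := by
  have h : (Finset.powersetCard k (Finset.univ : Finset (Fin N))).card = N.choose k := by simp
  rw [← h]
  refine Finset.card_nbij' (fun ω => Finset.univ.filter fun i => ω i = true)
    (fun s i => decide (i ∈ s)) ?_ ?_ ?_ ?_
  · intro ω hω
    have h : cnt ω = k := (Finset.mem_filter.mp hω).2
    exact Finset.mem_powersetCard.mpr ⟨Finset.subset_univ _, h⟩
  · intro s hs
    have h := (Finset.mem_powersetCard.mp hs).2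
    exact Finset.mem_filter.mpr ⟨Finset.mem_univ _, by simpa [cnt] using h⟩
  · intro ω _
    ext i
    simp
  · intro s _
    ext i
    simp

lemma cnt_comp_perm {N : ℕ} (π : Equiv.Perm (Fin N)) (ω : Fin N → Bool) :
    cnt (fun i => ω (π i)) = cnt ω := by
  unfold cnt
  refine Finset.card_bijective π π.bijective ?_
  intro i
  simp

lemma exists_perm_of_cnt_eq {N : ℕ} {ω ω' : Fin N → Bool} (h : cnt ω = cnt ω') :
    ∃ π : Equiv.Perm (Fin N), (fun i => ω' (π i)) = ω := by
  have hc : Fintype.card {i // ω i = true} = Fintype.card {i // ω' i = true} := by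
    rw [Fintype.card_subtype, Fintype.card_subtype]
    exact h
  let e := Fintype.equivOfCardEq hc
  refine ⟨e.extendSubtype, funext fun i => ?_⟩
  by_cases hi : ω i = true
  · rw [hi]
    exact e.extendSubtype_mem i hi
  · have := e.extendSubtype_not_mem i hi
    simp only [Bool.not_eq_true] at hi this
    rw [hi, this]

/-- An exchangeable measure gives equal mass to sequences with the same number of 1s. -/
lemma measure_singleton_eq_of_cnt_eq {N : ℕ} {P : Measure (Fin N → Bool)}
    (hP : ∀ π : Equiv.Perm (Fin N), P.map (fun ω i => ω (π i)) = P)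
    {ω ω' : Fin N → Bool} (h : cnt ω = cnt ω') : P {ω} = P {ω'} := by
  obtain ⟨π, rfl⟩ := exists_perm_of_cnt_eq h
  conv_lhs => rw [← hP π]
  rw [Measure.map_apply (measurable_of_finite _) (measurableSet_singleton _)]
  congr 1
  ext η
  simp only [Set.mem_preimage, Set.mem_singleton_iff]
  constructor
  · intro hη
    ext i
    simpa using congrFun hη (π.symm i)
  · rintro rfl
    rfl

/-- The uniform distribution on the sequences of length `N` with `k` ones. -/
noncomputable def uniformLevel (N k : ℕ) : Measure (Fin N → Bool) :=
  ((N.choose k : ℝ≥0∞))⁻¹ •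
    ∑ ω ∈ Finset.univ.filter (fun ω : Fin N → Bool => cnt ω = k), Measure.dirac ω

lemma lintegral_uniformLevel (N k : ℕ) (f : (Fin N → Bool) → ℝ≥0∞) :
    ∫⁻ ω, f ω ∂(uniformLevel N k) = ((N.choose k : ℝ≥0∞))⁻¹ *
      ∑ ω ∈ Finset.univ.filter (fun ω : Fin N → Bool => cnt ω = k), f ω := by
  simp [uniformLevel, lintegral_smul_measure, lintegral_finsetSum_measure, lintegral_dirac]

lemma isProbabilityMeasure_uniformLevel {N k : ℕ} (hk : k ≤ N) :
    IsProbabilityMeasure (uniformLevel N k) := by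
  constructor
  rw [← lintegral_one, lintegral_uniformLevel]
  simp only [Finset.sum_const, card_filter_cnt_eq, nsmul_eq_mul, mul_one]
  exact ENNReal.inv_mul_cancel (by exact_mod_cast (Nat.choose_pos hk).ne')
    (ENNReal.natCast_ne_top _)

lemma map_perm_uniformLevel (N k : ℕ) (π : Equiv.Perm (Fin N)) :
    (uniformLevel N k).map (fun ω i => ω (π i)) = uniformLevel N k := by
  ext s hs
  have hm : Measurable fun (ω : Fin N → Bool) i => ω (π i) := measurable_of_finite _
  rw [← lintegral_indicator_one hs, ← lintegral_indicator_one hs,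
    lintegral_map (measurable_of_finite _) hm, lintegral_uniformLevel, lintegral_uniformLevel]
  congr 1
  refine Finset.sum_nbij' (fun ω i => ω (π i)) (fun ω i => ω (π.symm i)) ?_ ?_ ?_ ?_ ?_
  · intro ω hω
    simpa [cnt_comp_perm] using hω
  · intro ω hω
    simpa [cnt_comp_perm] using hω
  all_goals simp

lemma sum_mul_measure_singleton_le {N k : ℕ} {P : Measure (Fin N → Bool)}
    (hP : ∀ π : Equiv.Perm (Fin N), P.map (fun ω i => ω (π i)) = P)
    {f : (Fin N → Bool) → ℝ≥0∞} (hk : k ≤ N)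
    (hf : ((N.choose k : ℝ≥0∞))⁻¹ *
      ∑ ω ∈ Finset.univ.filter (fun ω : Fin N → Bool => cnt ω = k), f ω ≤ 1) :
    ∑ ω ∈ Finset.univ.filter (fun ω : Fin N → Bool => cnt ω = k), f ω * P {ω} ≤
      ∑ ω ∈ Finset.univ.filter (fun ω : Fin N → Bool => cnt ω = k), P {ω} := by
  have hpos := Nat.choose_pos hk
  obtain ⟨ω₀, h₀⟩ := Finset.card_pos.mp ((card_filter_cnt_eq N k).symm ▸ hpos)
  have hconst : ∀ ω ∈ Finset.univ.filter (fun ω : Fin N → Bool => cnt ω = k),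
      P {ω} = P {ω₀} := fun ω hω => measure_singleton_eq_of_cnt_eq hP <| by
    rw [(Finset.mem_filter.mp hω).2, (Finset.mem_filter.mp h₀).2]
  rw [ENNReal.inv_mul_le_iff (by exact_mod_cast hpos.ne') (ENNReal.natCast_ne_top _),
    mul_one] at hf
  rw [Finset.sum_congr rfl hconst,
    Finset.sum_congr rfl (fun ω hω => congrArg (f ω * ·) (hconst ω hω)), ← Finset.sum_mul,
    Finset.sum_const, card_filter_cnt_eq, nsmul_eq_mul]
  gcongr

/-- a function `f : {0,1}^N → [0,∞]` satisfies `∫ f dP ≤ 1` for every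
exchangeable probability measure `P` iff for every `k ∈ {0,…,N}`,
`binom(N,k)⁻¹ · Σ_{ω : +ω = k} f(ω) ≤ 1`. -/
theorem stmt13 (N : ℕ) (hN : 1 ≤ N) (f : (Fin N → Bool) → ℝ≥0∞) :
    (∀ (P : Measure (Fin N → Bool)) [IsProbabilityMeasure P],
      (∀ π : Equiv.Perm (Fin N), P.map (fun ω i => ω (π i)) = P) →
      ∫⁻ ω, f ω ∂P ≤ 1) ↔
    (∀ k ≤ N, ((N.choose k : ℝ≥0∞))⁻¹ *
      ∑ ω ∈ Finset.univ.filter (fun ω : Fin N → Bool => cnt ω = k), f ω ≤ 1) := by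
  constructor
  · intro h k hk
    have := isProbabilityMeasure_uniformLevel hk
    rw [← lintegral_uniformLevel]
    exact h _ (map_perm_uniformLevel N k)
  · intro h P _ hP
    have hcnt : ∀ ω ∈ (Finset.univ : Finset (Fin N → Bool)), cnt ω ∈ Finset.range (N + 1) :=
      fun ω _ => Finset.mem_range_succ_iff.mpr <| (Finset.card_le_univ _).trans (by simp)
    calc ∫⁻ ω, f ω ∂P = ∑ ω, f ω * P {ω} := lintegral_fintype f
      _ = ∑ k ∈ Finset.range (N + 1), ∑ ω ∈ Finset.univ.filter
            (fun ω : Fin N → Bool => cnt ω = k), f ω * P {ω} :=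
          (Finset.sum_fiberwise_of_maps_to hcnt _).symm
      _ ≤ ∑ k ∈ Finset.range (N + 1), ∑ ω ∈ Finset.univ.filter
            (fun ω : Fin N → Bool => cnt ω = k), P {ω} :=
          Finset.sum_le_sum fun k hk =>
            have hk := Finset.mem_range_succ_iff.mp hk
            sum_mul_measure_singleton_le hP hk (h k hk)
      _ = ∑ ω, P {ω} := Finset.sum_fiberwise_of_maps_to hcnt _
      _ = 1 := by simp
end

section
/- There exists a universal constant c > 0 such that for every N ≥ 1 the following holds. Define N* = ⌊(π/2)·N^{1/2}⌋ and grid points p(a) = sin²(a·N^{−1/2}) for a = 1,…,N*−1; define the estimator E : {0,…,N} → [0,1] by E(k) = p(a) where p(a) is the largest grid point with p(a) ≤ k/N, and E(k) = p(1) if no grid point is ≤ k/N; let 𝔄(k) = {j ∈ {0,…,N} : E(j) = E(k)} be the cell of the induced partition containing k. Call h : {0,…,N} → [0,∞] a sin-e-function if for every k, |𝔄(k)|^{−1} · Σ_{j∈𝔄(k)} h(j) ≤ 1, and a binomial e-function if Σ_{k=0}^N binom(N,k) p^k (1−p)^{N−k} h(k) ≤ 1 for every p ∈ [0,1]. Then: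 (a) for every sin-e-function h, the function c^{−1}·h is a binomial e-function; (b) for every binomial e-function h, the function c^{−1}·h is a sin-e-function. -/
open MeasureTheory
open scoped ENNReal

/-- `N* = ⌊(π/2)·√N⌋`. -/
noncomputable def Nstar (N : ℕ) : ℕ := ⌊(Real.pi / 2) * Real.sqrt N⌋₊

/-- The grid point `p(a) = sin²(a·N^{-1/2})`. -/
noncomputable def gridpt (N a : ℕ) : ℝ := Real.sin ((a : ℝ) / Real.sqrt N) ^ 2

/-- The estimator `E : {0,…,N} → [0,1]`: `E(k)` is the largest grid point
`p(a)`, `a ∈ {1,…,N*-1}`, with `p(a) ≤ k/N` (the grid is increasing on this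
range, so this is the nearest grid point below `k/N`, attained at the largest
such index `a`); if there is no such grid point, `E(k) = p(1)`. -/
noncomputable def Est (N k : ℕ) : ℝ :=
  letI : DecidablePred fun a : ℕ => gridpt N a ≤ (k : ℝ) / N := Classical.decPred _
  let S := (Finset.Icc 1 (Nstar N - 1)).filter fun a => gridpt N a ≤ (k : ℝ) / N
  if hS : S.Nonempty then gridpt N (S.max' hS) else gridpt N 1

/-- The cell `𝔄(k) = E⁻¹(E(k))` of the partition of `{0,…,N}` induced by `E`. -/
noncomputable def cell (N k : ℕ) : Finset ℕ :=
  letI : DecidablePred fun j : ℕ => Est N j = Est N k := Classical.decPred _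
  (Finset.range (N + 1)).filter fun j => Est N j = Est N k

/-- `h` is an e-function w.r.t. the sin model (the uniform probability measures
on the cells of the partition induced by `E`). -/
noncomputable def sinE (N : ℕ) (h : ℕ → ℝ≥0∞) : Prop :=
  ∀ k ≤ N, ((cell N k).card : ℝ≥0∞)⁻¹ * ∑ j ∈ cell N k, h j ≤ 1

/-- `h` is an e-function w.r.t. the family of binomial measures on `{0,…,N}`. -/
noncomputable def binE (N : ℕ) (h : ℕ → ℝ≥0∞) : Prop :=
  ∀ p : ℝ≥0∞, p ≤ 1 →
    ∑ k ∈ Finset.range (N + 1),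
      (N.choose k : ℝ≥0∞) * p ^ k * (1 - p) ^ (N - k) * h k ≤ 1

lemma one_le_stirlingSeq {n : ℕ} (hn : n ≠ 0) : 1 ≤ Stirling.stirlingSeq n :=
  (Real.one_le_sqrt.2 (by linarith [Real.pi_gt_three])).trans
    (Stirling.sqrt_pi_le_stirlingSeq hn)

lemma stirlingSeq_le_two {n : ℕ} (hn : n ≠ 0) : Stirling.stirlingSeq n ≤ 2 := by
  obtain ⟨m, rfl⟩ := Nat.exists_eq_succ_of_ne_zero hn
  have h : Stirling.stirlingSeq (m + 1) ≤ Stirling.stirlingSeq 1 :=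
    Stirling.stirlingSeq'_antitone (Nat.zero_le m)
  refine h.trans ?_
  rw [Stirling.stirlingSeq_one, div_le_iff₀ (by positivity)]
  have h2 : (1.4 : ℝ) ≤ √2 := Real.le_sqrt_of_sq_le (by norm_num)
  linarith [Real.exp_one_lt_d9]

lemma factorial_mul_exp_eq {n : ℕ} (hn : n ≠ 0) :
    (n.factorial : ℝ) * Real.exp 1 ^ n = Stirling.stirlingSeq n * (√(2 * n) * (n : ℝ) ^ n) := by
  have : (0 : ℝ) < n := by positivity
  rw [Stirling.stirlingSeq, div_pow]
  field_simp

/-- Two-sided bound on the modal binomial probability, with `x²` and `y²` the success and failure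
probabilities `u / (u + v)` and `v / (u + v)`. -/
lemma choose_mul_sq_pow_bounds {u v : ℕ} (hu : u ≠ 0) (hv : v ≠ 0) {x y : ℝ}
    (hx : 0 ≤ x) (hy : 0 ≤ y) (hux : (u : ℝ) = ((u + v : ℕ) : ℝ) * x ^ 2)
    (hvy : (v : ℝ) = ((u + v : ℕ) : ℝ) * y ^ 2) :
    1 / 4 ≤ ((u + v).choose u : ℝ) * ((x ^ 2) ^ u * (y ^ 2) ^ v) * (√(2 * (u + v : ℕ)) * x * y) ∧
    ((u + v).choose u : ℝ) * ((x ^ 2) ^ u * (y ^ 2) ^ v) * (√(2 * (u + v : ℕ)) * x * y) ≤ 2 := by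
  have hn : u + v ≠ 0 := by omega
  have hchoose : ((u + v).choose u : ℝ) * u.factorial * v.factorial = (u + v).factorial := by
    have := Nat.choose_mul_factorial_mul_factorial (Nat.le_add_right u v)
    rw [add_tsub_cancel_left] at this
    exact_mod_cast this
  have eu := factorial_mul_exp_eq hu
  have ev := factorial_mul_exp_eq hv
  have en := factorial_mul_exp_eq hn
  have lu := one_le_stirlingSeq hu
  have lv := one_le_stirlingSeq hv
  have ln := one_le_stirlingSeq hn
  have uu := stirlingSeq_le_two hu
  have uv := stirlingSeq_le_two hv
  have un := stirlingSeq_le_two hn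
  have hn0 : (0 : ℝ) < ((u + v : ℕ) : ℝ) := by positivity
  generalize hN : ((u + v : ℕ) : ℝ) = n at *
  have su : √(2 * (u : ℝ)) = √(2 * n) * x := by
    rw [hux, ← mul_assoc, Real.sqrt_mul (by positivity), Real.sqrt_sq hx]
  have sv : √(2 * (v : ℝ)) = √(2 * n) * y := by
    rw [hvy, ← mul_assoc, Real.sqrt_mul (by positivity), Real.sqrt_sq hy]
  have pu : (u : ℝ) ^ u = n ^ u * (x ^ 2) ^ u := by rw [← mul_pow, ← hux]
  have pv : (v : ℝ) ^ v = n ^ v * (y ^ 2) ^ v := by rw [← mul_pow, ← hvy]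
  rw [su, pu] at eu
  rw [sv, pv] at ev
  generalize Stirling.stirlingSeq u = a at *
  generalize Stirling.stirlingSeq v = b at *
  generalize Stirling.stirlingSeq (u + v) = c at *
  set w := ((u + v).choose u : ℝ) * ((x ^ 2) ^ u * (y ^ 2) ^ v) * (√(2 * n) * x * y) with hw
  have hw0 : 0 ≤ w := by positivity
  have key : w * (a * b) = c := by
    have hs : 0 < √(2 * n) * n ^ (u + v) := by positivity
    apply mul_right_cancel₀ hs.ne'
    rw [← en, ← hchoose, pow_add (Real.exp 1)]
    calc w * (a * b) * (√(2 * n) * n ^ (u + v))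
        = ((u + v).choose u : ℝ) * (a * (√(2 * n) * x * (n ^ u * (x ^ 2) ^ u)))
          * (b * (√(2 * n) * y * (n ^ v * (y ^ 2) ^ v))) := by rw [hw, pow_add]; ring
      _ = _ := by rw [← eu, ← ev]; ring
  have hab1 : 1 ≤ a * b := by nlinarith
  have hab4 : a * b ≤ 4 := by nlinarith
  constructor
  · nlinarith
  · nlinarith

/-- The binomial probability of `k` at the parameter `sin² φ`. -/
noncomputable def binomSin (N k : ℕ) (φ : ℝ) : ℝ :=
  (N.choose k : ℝ) * ((Real.sin φ ^ 2) ^ k * (Real.cos φ ^ 2) ^ (N - k))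

/-- The angle `θ ∈ [0, π/2]` with `sin² θ = k / N`. -/
noncomputable def binomAngle (N k : ℕ) : ℝ := Real.arcsin √((k : ℝ) / N)

section angle

variable {N k : ℕ}

lemma binomAngle_nonneg : 0 ≤ binomAngle N k := Real.arcsin_nonneg.2 (Real.sqrt_nonneg _)

lemma binomAngle_le : binomAngle N k ≤ Real.pi / 2 := Real.arcsin_le_pi_div_two _

lemma sin_binomAngle_nonneg : 0 ≤ Real.sin (binomAngle N k) :=
  Real.sin_nonneg_of_nonneg_of_le_pi binomAngle_nonneg
    (binomAngle_le.trans (by linarith [Real.pi_pos]))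

lemma cos_binomAngle_nonneg : 0 ≤ Real.cos (binomAngle N k) :=
  Real.cos_nonneg_of_neg_pi_div_two_le_of_le
    (by linarith [Real.pi_pos, binomAngle_nonneg (N := N) (k := k)]) binomAngle_le

lemma sin_binomAngle_sq (hN : 1 ≤ N) (hk : k ≤ N) :
    Real.sin (binomAngle N k) ^ 2 = (k : ℝ) / N := by
  have hN' : (0 : ℝ) < N := by exact_mod_cast hN
  rw [binomAngle, Real.sin_arcsin, Real.sq_sqrt (by positivity)]
  · linarith [Real.sqrt_nonneg ((k : ℝ) / N)]
  · exact Real.sqrt_le_one.2 (div_le_one_of_le₀ (by exact_mod_cast hk) hN'.le)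

lemma natCast_eq_mul_sin_sq (hN : 1 ≤ N) (hk : k ≤ N) :
    (k : ℝ) = N * Real.sin (binomAngle N k) ^ 2 := by
  have hN' : (0 : ℝ) < N := by exact_mod_cast hN
  rw [sin_binomAngle_sq hN hk]
  field_simp

lemma natCast_sub_eq_mul_cos_sq (hN : 1 ≤ N) (hk : k ≤ N) :
    ((N - k : ℕ) : ℝ) = N * Real.cos (binomAngle N k) ^ 2 := by
  rw [Real.cos_sq', mul_sub, ← natCast_eq_mul_sin_sq hN hk, Nat.cast_sub hk, mul_one]

lemma sin_two_mul_binomAngle_nonneg : 0 ≤ Real.sin (2 * binomAngle N k) := by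
  rw [Real.sin_two_mul]
  have := sin_binomAngle_nonneg (N := N) (k := k)
  have := cos_binomAngle_nonneg (N := N) (k := k)
  positivity

lemma binomSin_binomAngle_bounds (hN : 1 ≤ N) (hk : k ≤ N) :
    1 / 4 ≤ binomSin N k (binomAngle N k) * (1 + √N * Real.sin (2 * binomAngle N k)) ∧
    binomSin N k (binomAngle N k) * (1 + √N * Real.sin (2 * binomAngle N k)) ≤ 8 := by
  have hN' : (0 : ℝ) < N := by exact_mod_cast hN
  have hs := natCast_eq_mul_sin_sq hN hk
  have hc := natCast_sub_eq_mul_cos_sq hN hk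
  have hs0 := sin_binomAngle_nonneg (N := N) (k := k)
  have hc0 := cos_binomAngle_nonneg (N := N) (k := k)
  have hsc := Real.sin_sq_add_cos_sq (binomAngle N k)
  unfold binomSin
  rw [Real.sin_two_mul]
  generalize Real.sin (binomAngle N k) = x at *
  generalize Real.cos (binomAngle N k) = y at *
  rcases Nat.eq_zero_or_pos k with rfl | hk0
  · have hx : x = 0 := by simpa [hN'.ne'] using hs.symm
    have hy : y ^ 2 = 1 := by rw [hx] at hsc; linarith
    norm_num [hx, hy]
  rcases Nat.eq_zero_or_pos (N - k) with h0 | hk1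
  · have hy : y = 0 := by simpa [hN'.ne', h0] using hc.symm
    have hx : x ^ 2 = 1 := by rw [hy] at hsc; linarith
    have : k = N := by omega
    norm_num [hx, hy, this]
  obtain ⟨v, rfl⟩ := Nat.exists_eq_add_of_le hk
  simp only [add_tsub_cancel_left] at *
  obtain ⟨h1, h2⟩ := choose_mul_sq_pow_bounds hk0.ne' hk1.ne' hs0 hc0 hs hc
  rw [Real.sqrt_mul (by norm_num)] at h1 h2
  generalize hW : ((k + v).choose k : ℝ) * ((x ^ 2) ^ k * (y ^ 2) ^ v) = W at *
  have hW0 : 0 ≤ W := by rw [← hW]; positivity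
  have hσ : 1 ≤ √((k + v : ℕ) : ℝ) * (2 * x * y) := by
    have h3 : (1 : ℝ) ≤ k := by exact_mod_cast hk0
    have h4 : (1 : ℝ) ≤ v := by exact_mod_cast hk1
    refine (one_le_sq_iff₀ (by positivity)).1 ?_
    rw [mul_pow, Real.sq_sqrt hN'.le]
    have : ((k + v : ℕ) : ℝ) * (((k + v : ℕ) : ℝ) * (2 * x * y) ^ 2) = 4 * (k * v) := by
      rw [hs, hc]; ring
    push_cast at this hN' ⊢
    refine le_of_mul_le_mul_left ?_ hN'
    rw [this]
    nlinarith
  have hw2 : √2 ^ 2 = 2 := Real.sq_sqrt (by norm_num)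
  have hw1 : 1 ≤ √2 := Real.one_le_sqrt.2 (by norm_num)
  have hw3 : √2 ≤ 2 := by nlinarith
  set σ := √((k + v : ℕ) : ℝ) * (2 * x * y) with hσ'
  have e : √2 * (W * (√2 * √((k + v : ℕ) : ℝ) * x * y)) = W * σ := by
    rw [hσ']; linear_combination W * √((k + v : ℕ) : ℝ) * x * y * hw2
  constructor
  · nlinarith
  · have : W * σ ≤ 4 := by rw [← e]; nlinarith
    nlinarith

lemma pow_le_pow_mul_exp_div {x y : ℝ} (hx : 0 ≤ x) (hy : 0 < y) (n : ℕ) :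
    x ^ n ≤ y ^ n * Real.exp (n * (x / y - 1)) := by
  rw [Real.exp_nat_mul, ← mul_pow]
  refine pow_le_pow_left₀ hx ?_ n
  have h := Real.add_one_le_exp (x / y - 1)
  rw [sub_add_cancel, div_le_iff₀ hy] at h
  linarith

lemma pow_le_pow_mul_exp_of_eq_mul_sq {x y r : ℝ} {n : ℕ} (hx : 0 ≤ x) (hy : 0 ≤ y)
    (h : (n : ℝ) = r * x ^ 2) : y ^ n ≤ x ^ n * Real.exp (r * x * y - n) := by
  rcases Nat.eq_zero_or_pos n with rfl | hn
  · have : r * x = 0 := by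
      have h' : r = 0 ∨ x = 0 := by simpa using h.symm
      rcases h' with h' | h' <;> simp [h']
    simp [this]
  · have hn' : (0 : ℝ) < n := by exact_mod_cast hn
    have hx' : 0 < x := by
      refine hx.lt_of_ne fun h0 => ?_
      rw [← h0] at h
      norm_num at h
      omega
    refine (pow_le_pow_mul_exp_div hy hx' n).trans_eq ?_
    congr 2
    rw [h]
    field_simp

lemma binomSin_nonneg (φ : ℝ) : 0 ≤ binomSin N k φ := by unfold binomSin; positivity

lemma binomSin_le_mul_exp (hN : 1 ≤ N) (hk : k ≤ N) {φ : ℝ} (h0 : 0 ≤ φ)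
    (h1 : φ ≤ Real.pi / 2) :
    binomSin N k φ ≤ binomSin N k (binomAngle N k) *
      Real.exp (-(N * (binomAngle N k - φ) ^ 2 / 4)) := by
  have hpi := Real.pi_gt_three
  have hpi' := Real.pi_lt_four
  have hθ0 := binomAngle_nonneg (N := N) (k := k)
  have hθ1 := binomAngle_le (N := N) (k := k)
  have hs := natCast_eq_mul_sin_sq hN hk
  have hc := natCast_sub_eq_mul_cos_sq hN hk
  have hs0 := sin_binomAngle_nonneg (N := N) (k := k)
  have hc0 := cos_binomAngle_nonneg (N := N) (k := k)
  have hsφ : 0 ≤ Real.sin φ := Real.sin_nonneg_of_nonneg_of_le_pi h0 (by linarith)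
  have hcφ : 0 ≤ Real.cos φ := Real.cos_nonneg_of_neg_pi_div_two_le_of_le (by linarith) h1
  have hsin := pow_le_pow_mul_exp_of_eq_mul_sq hs0 hsφ hs
  have hcos := pow_le_pow_mul_exp_of_eq_mul_sq hc0 hcφ hc
  have hcd : Real.cos (binomAngle N k - φ) ≤ 1 - (binomAngle N k - φ) ^ 2 / 8 := by
    refine (Real.cos_le_one_sub_mul_cos_sq (abs_le.2 ⟨by linarith, by linarith⟩)).trans ?_
    have : 1 / 8 ≤ 2 / Real.pi ^ 2 := by
      rw [div_le_div_iff₀ (by norm_num) (by positivity)]; nlinarith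
    nlinarith [sq_nonneg (binomAngle N k - φ)]
  rw [Real.cos_sub] at hcd
  unfold binomSin
  rw [mul_assoc]
  refine mul_le_mul_of_nonneg_left ?_ (Nat.cast_nonneg _)
  have hprod := mul_le_mul hsin hcos (by positivity) (by positivity)
  have hsq := pow_le_pow_left₀ (by positivity) hprod 2
  have hexp : Real.exp (N * Real.sin (binomAngle N k) * Real.sin φ - k) ^ 2 *
      Real.exp (N * Real.cos (binomAngle N k) * Real.cos φ - (N - k : ℕ)) ^ 2 ≤
      Real.exp (-(N * (binomAngle N k - φ) ^ 2 / 4)) := by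
    rw [← Real.exp_nat_mul, ← Real.exp_nat_mul, ← Real.exp_add]
    refine Real.exp_le_exp.2 ?_
    rw [Nat.cast_sub hk]
    push_cast
    have := mul_le_mul_of_nonneg_left hcd (Nat.cast_nonneg (α := ℝ) N)
    linarith
  calc (Real.sin φ ^ 2) ^ k * (Real.cos φ ^ 2) ^ (N - k)
      = (Real.sin φ ^ k * Real.cos φ ^ (N - k)) ^ 2 := by ring
    _ ≤ _ := hsq
    _ = ((Real.sin (binomAngle N k) ^ 2) ^ k * (Real.cos (binomAngle N k) ^ 2) ^ (N - k)) *
        (Real.exp (N * Real.sin (binomAngle N k) * Real.sin φ - k) ^ 2 *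
        Real.exp (N * Real.cos (binomAngle N k) * Real.cos φ - (N - k : ℕ)) ^ 2) := by ring
    _ ≤ _ := mul_le_mul_of_nonneg_left hexp (by positivity)

lemma binomSin_binomAngle_le_mul_exp (hN : 1 ≤ N) (hk : k ≤ N) {φ : ℝ} (h0 : 0 < Real.sin φ)
    (h1 : 0 < Real.cos φ) :
    binomSin N k (binomAngle N k) ≤ binomSin N k φ *
      Real.exp (N * ((Real.sin (binomAngle N k) ^ 2 - Real.sin φ ^ 2) ^ 2 /
        (Real.sin φ ^ 2 * Real.cos φ ^ 2))) := by
  have hs := natCast_eq_mul_sin_sq hN hk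
  have hc := natCast_sub_eq_mul_cos_sq hN hk
  have hsin := pow_le_pow_mul_exp_div (sq_nonneg (Real.sin (binomAngle N k)))
    (pow_pos h0 2) k
  have hcos := pow_le_pow_mul_exp_div (sq_nonneg (Real.cos (binomAngle N k)))
    (pow_pos h1 2) (N - k)
  unfold binomSin
  rw [mul_assoc]
  refine mul_le_mul_of_nonneg_left ?_ (Nat.cast_nonneg _)
  refine (mul_le_mul hsin hcos (by positivity) (by positivity)).trans_eq ?_
  rw [mul_mul_mul_comm, ← Real.exp_add]
  congr 2
  rw [hc, hs]
  have h2 := Real.cos_sq' (binomAngle N k)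
  have h3 := Real.sin_sq_add_cos_sq φ
  rw [h2]
  field_simp
  rw [Real.cos_sq' φ]
  ring

/-- The index `a` of the cell `𝔄(k)`, so that `E(k) = p(a)`. -/
noncomputable def cellIndex (N k : ℕ) : ℕ :=
  max 1 (min (Nstar N - 1) ⌊√N * binomAngle N k⌋₊)

lemma Nstar_le (N : ℕ) : (Nstar N : ℝ) ≤ Real.pi / 2 * √N :=
  Nat.floor_le (by positivity)

lemma lt_Nstar_add_one (N : ℕ) : Real.pi / 2 * √N < Nstar N + 1 := Nat.lt_floor_add_one _

lemma one_le_sqrt_natCast (hN : 1 ≤ N) : 1 ≤ √(N : ℝ) :=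
  Real.one_le_sqrt.2 (by exact_mod_cast hN)

lemma one_le_Nstar (hN : 1 ≤ N) : 1 ≤ Nstar N :=
  Nat.le_floor (by nlinarith [one_le_sqrt_natCast hN, Real.pi_gt_three])

lemma gridpt_le_iff (hN : 1 ≤ N) (hk : k ≤ N) {a : ℕ} (ha : (a : ℝ) ≤ Real.pi / 2 * √N) :
    gridpt N a ≤ (k : ℝ) / N ↔ (a : ℝ) ≤ √N * binomAngle N k := by
  have hs : 0 < √(N : ℝ) := by linarith [one_le_sqrt_natCast hN]
  have hpi := Real.pi_pos
  have h0 : 0 ≤ (a : ℝ) / √N := by positivity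
  have h1 : (a : ℝ) / √N ≤ Real.pi / 2 := (div_le_iff₀ hs).2 ha
  rw [gridpt, ← sin_binomAngle_sq hN hk,
    sq_le_sq₀ (Real.sin_nonneg_of_nonneg_of_le_pi h0 (by linarith)) sin_binomAngle_nonneg,
    Real.strictMonoOn_sin.le_iff_le ⟨by linarith, h1⟩
      ⟨by linarith [binomAngle_nonneg (N := N) (k := k)], binomAngle_le⟩,
    div_le_iff₀' hs]

lemma one_le_cellIndex : 1 ≤ cellIndex N k := le_max_left _ _

lemma cellIndex_add_half_le (hN : 1 ≤ N) :
    (cellIndex N k : ℝ) + 1 / 2 ≤ Real.pi / 2 * √N := by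
  have h1 := one_le_Nstar hN
  have h2 := Nstar_le N
  have h : cellIndex N k ≤ max 1 (Nstar N - 1) := max_le_max le_rfl (min_le_left _ _)
  rcases le_max_iff.1 h with h | h
  · have : (cellIndex N k : ℝ) ≤ 1 := by exact_mod_cast h
    nlinarith [one_le_sqrt_natCast hN, Real.pi_gt_three]
  · have : (cellIndex N k : ℝ) + 1 ≤ Nstar N := by exact_mod_cast (by omega)
    linarith

lemma cellIndex_near (hN : 1 ≤ N) : |√N * binomAngle N k - cellIndex N k| ≤ 2 := by
  have hs : 0 < √(N : ℝ) := by linarith [one_le_sqrt_natCast hN]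
  have hN1 := one_le_Nstar hN
  have h0 : 0 ≤ √N * binomAngle N k := mul_nonneg hs.le binomAngle_nonneg
  have h1 : √N * binomAngle N k < Nstar N + 1 := by
    have := mul_le_mul_of_nonneg_left (binomAngle_le (N := N) (k := k)) hs.le
    linarith [lt_Nstar_add_one N]
  have hf := Nat.floor_le h0
  have hf' := Nat.lt_floor_add_one (√N * binomAngle N k)
  have hfle : ⌊√N * binomAngle N k⌋₊ ≤ Nstar N := by
    have : (⌊√N * binomAngle N k⌋₊ : ℝ) < ((Nstar N + 1 : ℕ) : ℝ) := by push_cast; linarith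
    have := Nat.cast_lt.1 this
    omega
  unfold cellIndex
  generalize √N * binomAngle N k = t at *
  generalize ⌊t⌋₊ = f at *
  have hA : max 1 (min (Nstar N - 1) f) ≤ f + 1 := by omega
  have hB : f ≤ max 1 (min (Nstar N - 1) f) + 1 := by omega
  have hA' : ((max 1 (min (Nstar N - 1) f) : ℕ) : ℝ) ≤ f + 1 := by exact_mod_cast hA
  have hB' : (f : ℝ) ≤ (max 1 (min (Nstar N - 1) f) : ℕ) + 1 := by exact_mod_cast hB
  rw [abs_le]
  constructor <;> linarith

lemma Est_eq_gridpt (hN : 1 ≤ N) (hk : k ≤ N) : Est N k = gridpt N (cellIndex N k) := by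
  have hs : 0 < √(N : ℝ) := by linarith [one_le_sqrt_natCast hN]
  have h0 : 0 ≤ √N * binomAngle N k := mul_nonneg hs.le binomAngle_nonneg
  have hmem : ∀ a ∈ Finset.Icc 1 (Nstar N - 1),
      (gridpt N a ≤ (k : ℝ) / N ↔ a ≤ ⌊√N * binomAngle N k⌋₊) := by
    intro a ha
    rw [Finset.mem_Icc] at ha
    rw [gridpt_le_iff hN hk, Nat.le_floor_iff h0]
    have : (a : ℝ) ≤ Nstar N := by exact_mod_cast (by omega)
    exact this.trans (Nstar_le N)
  unfold Est cellIndex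
  simp only
  split_ifs with hS
  · congr 1
    apply le_antisymm
    · have h := Finset.max'_mem _ hS
      rw [Finset.mem_filter] at h
      have h1 := (hmem _ h.1).1 h.2
      have h2 := Finset.mem_Icc.1 h.1
      exact le_max_of_le_right (le_min h2.2 h1)
    · obtain ⟨b, hb⟩ := hS
      rw [Finset.mem_filter] at hb
      have h1 := (hmem _ hb.1).1 hb.2
      have h2 := Finset.mem_Icc.1 hb.1
      refine Finset.le_max' _ _ (Finset.mem_filter.2 ?_)
      have h3 : max 1 (min (Nstar N - 1) ⌊√N * binomAngle N k⌋₊) ∈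
          Finset.Icc 1 (Nstar N - 1) := by rw [Finset.mem_Icc]; omega
      exact ⟨h3, (hmem _ h3).2 (by omega)⟩
  · congr 1
    by_contra hne
    refine hS ⟨1, Finset.mem_filter.2 ?_⟩
    have h3 : 1 ∈ Finset.Icc 1 (Nstar N - 1) := by rw [Finset.mem_Icc]; omega
    exact ⟨h3, (hmem _ h3).2 (by omega)⟩

lemma mem_cell_iff (hN : 1 ≤ N) (hk : k ≤ N) {j : ℕ} :
    j ∈ cell N k ↔ j ≤ N ∧ cellIndex N j = cellIndex N k := by
  have hs : 0 < √(N : ℝ) := by linarith [one_le_sqrt_natCast hN]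
  have hpi := Real.pi_pos
  simp only [cell, Finset.mem_filter, Finset.mem_range, Nat.lt_succ_iff]
  refine and_congr_right fun hj => ?_
  rw [Est_eq_gridpt hN hj, Est_eq_gridpt hN hk]
  refine ⟨fun h => ?_, fun h => by rw [h]⟩
  have hr : ∀ i, 0 ≤ (cellIndex N i : ℝ) / √N ∧ (cellIndex N i : ℝ) / √N ≤ Real.pi / 2 :=
    fun i => ⟨by positivity,
      (div_le_iff₀ hs).2 (by linarith [cellIndex_add_half_le (k := i) hN])⟩
  have hsn : ∀ i, 0 ≤ Real.sin ((cellIndex N i : ℝ) / √N) := fun i =>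
    Real.sin_nonneg_of_nonneg_of_le_pi (hr i).1 (by linarith [(hr i).2])
  have h' := (sq_eq_sq₀ (hsn j) (hsn k)).1 h
  have h'' := Real.strictMonoOn_sin.injOn ⟨by linarith [(hr j).1], (hr j).2⟩
    ⟨by linarith [(hr k).1], (hr k).2⟩ h'
  rw [div_left_inj' hs.ne'] at h''
  exact_mod_cast h''

/-- The order of magnitude of the size of the cell of index `a`. -/
noncomputable def cellScale (N a : ℕ) : ℝ := √N * Real.sin (2 * (a / √N))

lemma half_le_cellScale (hN : 1 ≤ N) : 1 / 2 ≤ cellScale N (cellIndex N k) := by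
  have hs : 0 < √(N : ℝ) := by linarith [one_le_sqrt_natCast hN]
  have h1 : (1 : ℝ) ≤ cellIndex N k := by exact_mod_cast one_le_cellIndex
  have h2 := cellIndex_add_half_le (k := k) hN
  have hpi := Real.pi_gt_three
  have hpi4 := Real.pi_le_four
  unfold cellScale
  set x := (cellIndex N k : ℝ) / √N with hx
  have hx' : √N * x = cellIndex N k := by rw [hx]; field_simp
  have h2pi : 1 / 2 ≤ 2 / Real.pi := by rw [div_le_div_iff₀ (by norm_num) (by positivity)]; linarith
  have hx0 : 0 ≤ x := by positivity
  have hx1 : x ≤ Real.pi / 2 := by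
    rw [hx, div_le_iff₀ hs]; linarith
  rcases le_total (2 * x) (Real.pi / 2) with h | h
  · have := Real.mul_le_sin (by positivity) h
    nlinarith
  · rw [← Real.sin_pi_sub]
    have h3 := Real.mul_le_sin (x := Real.pi - 2 * x) (by linarith) (by linarith)
    have h4 : 1 ≤ √N * (Real.pi - 2 * x) := by linarith
    have h5 : 0 ≤ Real.pi - 2 * x := by linarith
    have h6 := mul_le_mul_of_nonneg_left h3 hs.le
    nlinarith

lemma abs_binomAngle_sub_le (hN : 1 ≤ N) :
    √N * |binomAngle N k - cellIndex N k / √N| ≤ 2 := by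
  have hs : 0 < √(N : ℝ) := by linarith [one_le_sqrt_natCast hN]
  rw [← abs_of_pos hs, ← abs_mul, abs_of_pos hs, mul_sub, mul_div_cancel₀ _ hs.ne']
  exact cellIndex_near hN

lemma abs_cellScale_sub_le (hN : 1 ≤ N) :
    |cellScale N (cellIndex N k) - √N * Real.sin (2 * binomAngle N k)| ≤ 4 := by
  have hs : 0 < √(N : ℝ) := by linarith [one_le_sqrt_natCast hN]
  have h := abs_binomAngle_sub_le (k := k) hN
  rw [cellScale, ← mul_sub, abs_mul, abs_of_pos hs]
  have h2 := Real.abs_sin_sub_sin_le (2 * (cellIndex N k / √N)) (2 * binomAngle N k)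
  rw [← mul_sub, abs_mul, abs_two, abs_sub_comm (_ / _)] at h2
  nlinarith

lemma sin_sq_sub_sin_sq (x y : ℝ) :
    Real.sin x ^ 2 - Real.sin y ^ 2 = Real.sin (x - y) * Real.sin (x + y) := by
  rw [Real.sin_sub, Real.sin_add]
  linear_combination Real.sin y ^ 2 * Real.sin_sq_add_cos_sq x
    - Real.sin x ^ 2 * Real.sin_sq_add_cos_sq y

/-- The mean `N sin² (a / √N)` of the binomial measure attached to a cell is within the
order of magnitude of the cell size from every point of the cell. -/
lemma abs_mul_sin_sq_sub_le (hN : 1 ≤ N) :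
    |N * (Real.sin (binomAngle N k) ^ 2 - Real.sin (cellIndex N k / √N) ^ 2)| ≤
      10 * cellScale N (cellIndex N k) := by
  have hs : 0 < √(N : ℝ) := by linarith [one_le_sqrt_natCast hN]
  have hsq : √(N : ℝ) * √N = N := Real.mul_self_sqrt (Nat.cast_nonneg N)
  have h := abs_binomAngle_sub_le (k := k) hN
  have hhalf := half_le_cellScale (k := k) hN
  rw [sin_sq_sub_sin_sq]
  unfold cellScale at *
  set y := (cellIndex N k : ℝ) / √N
  set x := binomAngle N k
  have h1 := Real.abs_sin_le_abs (x := x - y)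
  have h2 := Real.abs_sin_sub_sin_le (x + y) (2 * y)
  rw [show x + y - 2 * y = x - y by ring] at h2
  have h3 : |Real.sin (x + y)| ≤ Real.sin (2 * y) + |x - y| := by
    have h4 := abs_sub_abs_le_abs_sub (Real.sin (x + y)) (Real.sin (2 * y))
    have h5 : 0 ≤ Real.sin (2 * y) := by
      by_contra! hneg
      nlinarith
    rw [abs_of_nonneg h5] at h4
    linarith
  have h6 : √N * |Real.sin (x - y)| ≤ 2 := (mul_le_mul_of_nonneg_left h1 hs.le).trans h
  have h7 : √N * |Real.sin (x + y)| ≤ 5 * (√N * Real.sin (2 * y)) := by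
    have := mul_le_mul_of_nonneg_left h3 hs.le
    linarith
  calc |(N : ℝ) * (Real.sin (x - y) * Real.sin (x + y))|
      = (√N * |Real.sin (x - y)|) * (√N * |Real.sin (x + y)|) := by
        rw [abs_mul, abs_mul, abs_of_nonneg (Nat.cast_nonneg N : (0 : ℝ) ≤ N)]
        linear_combination -(|Real.sin (x - y)| * |Real.sin (x + y)|) * hsq
    _ ≤ 2 * (5 * (√N * Real.sin (2 * y))) :=
        mul_le_mul h6 h7 (by positivity) (by norm_num)
    _ = 10 * (√N * Real.sin (2 * y)) := by ring

lemma card_cell_le (hN : 1 ≤ N) (hk : k ≤ N) :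
    ((cell N k).card : ℝ) ≤ 22 * cellScale N (cellIndex N k) := by
  have hhalf := half_le_cellScale (k := k) hN
  set s := cellScale N (cellIndex N k) with hs
  have hne : (cell N k).Nonempty := ⟨k, (mem_cell_iff hN hk).2 ⟨hk, rfl⟩⟩
  set m := (cell N k).min' hne with hm
  have hdist : ∀ j ∈ cell N k,
      |(j : ℝ) - N * Real.sin (cellIndex N k / √N) ^ 2| ≤ 10 * s := by
    intro j hj
    obtain ⟨hjN, hj⟩ := (mem_cell_iff hN hk).1 hj
    have := abs_mul_sin_sq_sub_le (k := j) hN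
    rwa [hj, mul_sub, ← natCast_eq_mul_sin_sq hN hjN] at this
  have hsub : cell N k ⊆ Finset.Icc m (m + ⌊20 * s⌋₊) := by
    intro j hj
    have hmj : m ≤ j := Finset.min'_le _ _ hj
    refine Finset.mem_Icc.2 ⟨hmj, ?_⟩
    have h1 := abs_le.1 (hdist j hj)
    have h2 := abs_le.1 (hdist m (Finset.min'_mem _ hne))
    have : j - m ≤ ⌊20 * s⌋₊ := by
      refine Nat.le_floor ?_
      rw [Nat.cast_sub hmj]
      linarith [h1.1, h1.2, h2.1, h2.2]
    omega
  have hcard := Finset.card_le_card hsub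
  rw [Nat.card_Icc, show m + ⌊20 * s⌋₊ + 1 - m = ⌊20 * s⌋₊ + 1 by omega] at hcard
  have hcard' : ((cell N k).card : ℝ) ≤ ⌊20 * s⌋₊ + 1 := by exact_mod_cast hcard
  linarith [Nat.floor_le (show 0 ≤ 20 * s by linarith)]

lemma cellIndex_eq_of_mem {a j : ℕ} (hN : 1 ≤ N) (ha : 1 ≤ a) (haN : a < Nstar N - 1)
    (hj : N * Real.sin (a / √N) ^ 2 ≤ j) (hj' : (j : ℝ) < N * Real.sin ((a + 1 : ℕ) / √N) ^ 2) :
    j ≤ N ∧ cellIndex N j = a := by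
  have hN' : (0 : ℝ) < N := by exact_mod_cast hN
  have hM := Nstar_le N
  have ha1 : ((a + 1 : ℕ) : ℝ) ≤ Real.pi / 2 * √N :=
    (Nat.cast_le.2 (by omega : a + 1 ≤ Nstar N)).trans hM
  have ha0 : (a : ℝ) ≤ Real.pi / 2 * √N := (Nat.cast_le.2 (Nat.le_succ a)).trans ha1
  have hjN : j ≤ N := by
    have h := Real.sin_sq_le_one ((a + 1 : ℕ) / √N)
    have : (j : ℝ) ≤ N := by nlinarith
    exact_mod_cast this
  refine ⟨hjN, ?_⟩
  have h0 : 0 ≤ √N * binomAngle N j := mul_nonneg (Real.sqrt_nonneg _) binomAngle_nonneg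
  have h1 : a ≤ ⌊√N * binomAngle N j⌋₊ := by
    refine Nat.le_floor ((gridpt_le_iff hN hjN ha0).1 ?_)
    rw [gridpt, le_div_iff₀ hN', mul_comm]
    exact hj
  have h2 : ⌊√N * binomAngle N j⌋₊ < a + 1 := by
    rw [Nat.floor_lt h0]
    refine not_le.1 fun h => ?_
    have := (gridpt_le_iff hN hjN ha1).2 h
    rw [gridpt, le_div_iff₀ hN', mul_comm] at this
    linarith
  unfold cellIndex
  omega

lemma cellScale_le_card (hN : 1 ≤ N) (hk : k ≤ N) :
    cellScale N (cellIndex N k) ≤ 6 * (cell N k).card := by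
  have hs : 1 ≤ √(N : ℝ) := one_le_sqrt_natCast hN
  have hs0 : 0 < √(N : ℝ) := by linarith
  have hsq : √(N : ℝ) * √N = N := Real.mul_self_sqrt (Nat.cast_nonneg N)
  have hpi := Real.pi_gt_three
  have hpi4 := Real.pi_le_four
  have hcard : (1 : ℝ) ≤ (cell N k).card := by
    exact_mod_cast Finset.card_pos.2 ⟨k, (mem_cell_iff hN hk).2 ⟨hk, rfl⟩⟩
  have ha1 : 1 ≤ cellIndex N k := one_le_cellIndex
  have hahalf := cellIndex_add_half_le (k := k) hN
  have hle : cellIndex N k ≤ max 1 (Nstar N - 1) := max_le_max le_rfl (min_le_left _ _)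
  have hmem : ∀ j, j ≤ N ∧ cellIndex N j = cellIndex N k → j ∈ cell N k :=
    fun j hj => (mem_cell_iff hN hk).2 hj
  generalize cellIndex N k = a at *
  have hx' : √N * ((a : ℝ) / √N) = a := by field_simp
  by_cases h1 : a = 1
  · have : Real.sin (2 * (a / √N)) ≤ 2 * (a / √N) := Real.sin_le (by positivity)
    have h2 := mul_le_mul_of_nonneg_left this hs0.le
    have h3 : (a : ℝ) = 1 := by exact_mod_cast h1
    unfold cellScale
    linarith
  by_cases h2 : a = Nstar N - 1
  · have h3 : (a : ℝ) + 1 = Nstar N := by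
      have : a + 1 = Nstar N := by omega
      exact_mod_cast this
    have h4 := lt_Nstar_add_one N
    have h5 : (a : ℝ) / √N ≤ Real.pi / 2 := (div_le_iff₀ hs0).2 (by linarith)
    have := Real.sin_le (x := Real.pi - 2 * (a / √N)) (by linarith)
    rw [Real.sin_pi_sub] at this
    have h2 := mul_le_mul_of_nonneg_left this hs0.le
    unfold cellScale
    linarith
  · have haN : a < Nstar N - 1 := by omega
    set x := N * Real.sin (a / √N) ^ 2 with hx
    set y := N * Real.sin ((a + 1 : ℕ) / √N) ^ 2 with hy
    have hsub : Finset.Ico ⌈x⌉₊ ⌈y⌉₊ ⊆ cell N k := by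
      intro j hj
      obtain ⟨hj1, hj2⟩ := Finset.mem_Ico.1 hj
      exact hmem j (cellIndex_eq_of_mem hN ha1 haN (Nat.ceil_le.1 hj1) (Nat.lt_ceil.1 hj2))
    have h3 := Finset.card_le_card hsub
    rw [Nat.card_Ico] at h3
    have h4 : y - x - 1 ≤ (cell N k).card := by
      have h5 : (⌈y⌉₊ : ℝ) ≤ ⌈x⌉₊ + (cell N k).card := by exact_mod_cast (by omega)
      have h6 := Nat.ceil_lt_add_one (show 0 ≤ x by positivity)
      have h7 := Nat.le_ceil y
      linarith
    have hδ0 : 0 < 1 / √(N : ℝ) := by positivity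
    have hδ1 : 1 / √(N : ℝ) ≤ 1 := by rw [div_le_one hs0]; exact hs
    have hδs : √N * (1 / √(N : ℝ)) = 1 := by field_simp
    have hdiff : y - x = (√N * Real.sin (1 / √N)) * (√N * Real.sin (2 * (a / √N) + 1 / √N)) := by
      rw [hy, hx, ← mul_sub, sin_sq_sub_sin_sq]
      have e1 : ((a + 1 : ℕ) : ℝ) / √N - a / √N = 1 / √N := by push_cast; ring
      have e2 : ((a + 1 : ℕ) : ℝ) / √N + a / √N = 2 * (a / √N) + 1 / √N := by push_cast; ring
      rw [e1, e2]
      linear_combination -(Real.sin (1 / √N) * Real.sin (2 * (a / √N) + 1 / √N)) * hsq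
    have hδ : 1 / 2 ≤ √N * Real.sin (1 / √N) := by
      have := Real.mul_le_sin hδ0.le (by linarith)
      have h2pi : 1 / 2 ≤ 2 / Real.pi := by
        rw [div_le_div_iff₀ (by norm_num) (by positivity)]; linarith
      nlinarith
    have hmid : cellScale N a - 1 ≤ √N * Real.sin (2 * (a / √N) + 1 / √N) := by
      have := (abs_le.1 (Real.abs_sin_sub_sin_le (2 * (a / √N) + 1 / √N) (2 * (a / √N)))).1
      rw [add_sub_cancel_left, abs_of_pos hδ0] at this
      unfold cellScale
      nlinarith
    rcases le_total (cellScale N a) 6 with h6 | h6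
    · linarith
    · have : 1 / 2 * (cellScale N a - 1) ≤ y - x := by
        rw [hdiff]
        exact mul_le_mul hδ hmid (by linarith) (by linarith)
      nlinarith

lemma exp_neg_div_four_le {z : ℝ} (hz : 0 ≤ z) : Real.exp (-(z / 4)) ≤ 4 / (1 + z) := by
  rw [Real.exp_neg, ← one_div, div_le_div_iff₀ (Real.exp_pos _) (by linarith)]
  linarith [Real.add_one_le_exp (z / 4)]

lemma card_mul_binomSin_le (hN : 1 ≤ N) (hk : k ≤ N) {φ : ℝ} (h0 : 0 ≤ φ)
    (h1 : φ ≤ Real.pi / 2) :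
    (cell N k).card * binomSin N k φ ≤
      76032 * (1 / (1 + ((cellIndex N k : ℝ) - ⌊√N * φ⌋₊) ^ 2)) := by
  have hW := (binomSin_binomAngle_bounds hN hk).2
  have hexp := binomSin_le_mul_exp hN hk h0 h1
  have hcard := card_cell_le hN hk
  have hscale := (abs_le.1 (abs_cellScale_sub_le (k := k) hN)).2
  have hσ : 0 ≤ √N * Real.sin (2 * binomAngle N k) :=
    mul_nonneg (Real.sqrt_nonneg _) sin_two_mul_binomAngle_nonneg
  have hnear := abs_le.1 (cellIndex_near (k := k) hN)
  have hu := Nat.floor_le (show 0 ≤ √N * φ by positivity)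
  have hu' := Nat.lt_floor_add_one (√N * φ)
  have hsq : √(N : ℝ) ^ 2 = N := Real.sq_sqrt (Nat.cast_nonneg N)
  have hz : (N : ℝ) * (binomAngle N k - φ) ^ 2 =
      (√N * binomAngle N k - √N * φ) ^ 2 := by rw [← mul_sub, mul_pow, hsq]
  rw [hz] at hexp
  have hW0 := binomSin_nonneg (N := N) (k := k) (binomAngle N k)
  generalize √N * binomAngle N k = t at *
  generalize √N * φ = u at *
  generalize √N * Real.sin (2 * binomAngle N k) = σ at *
  generalize binomSin N k (binomAngle N k) = W at *
  have he := exp_neg_div_four_le (sq_nonneg (t - u))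
  have he0 := Real.exp_pos (-((t - u) ^ 2 / 4))
  generalize Real.exp (-((t - u) ^ 2 / 4)) = e at *
  have h3 : ((cell N k).card : ℝ) * binomSin N k φ ≤ 704 * e := by
    calc ((cell N k).card : ℝ) * binomSin N k φ
        ≤ (88 * (1 + σ)) * (W * e) :=
          mul_le_mul (by linarith) hexp (binomSin_nonneg _) (by positivity)
      _ = 88 * (W * (1 + σ)) * e := by ring
      _ ≤ 88 * 8 * e := by gcongr
      _ = 704 * e := by norm_num
  have h4 : 4 / (1 + (t - u) ^ 2) ≤ 108 * (1 / (1 + ((cellIndex N k : ℝ) - ⌊u⌋₊) ^ 2)) := by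
    rw [mul_one_div, div_le_div_iff₀ (by positivity) (by positivity)]
    generalize (cellIndex N k : ℝ) = a at *
    generalize (⌊u⌋₊ : ℝ) = m at *
    have h5 : (a - u) ^ 2 ≤ 2 * (t - u) ^ 2 + 8 := by
      nlinarith [sq_nonneg ((t - u) + (t - a)), hnear.1, hnear.2]
    have h6 : (a - m) ^ 2 ≤ 2 * (a - u) ^ 2 + 2 := by
      nlinarith [sq_nonneg ((a - u) - (u - m))]
    nlinarith [sq_nonneg (t - u)]
  linarith

lemma one_le_mul_card_mul_binomSin (hN : 1 ≤ N) (hk : k ≤ N) :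
    1 ≤ 264 * Real.exp 400 * ((cell N k).card * binomSin N k (cellIndex N k / √N)) := by
  have hs : 0 < √(N : ℝ) := by linarith [one_le_sqrt_natCast hN]
  have hN' : (0 : ℝ) < N := by exact_mod_cast hN
  have hW := (binomSin_binomAngle_bounds hN hk).1
  have hhalf := half_le_cellScale (k := k) hN
  have hcard := cellScale_le_card hN hk
  have hscale := (abs_le.1 (abs_cellScale_sub_le (k := k) hN)).1
  have hdist := abs_mul_sin_sq_sub_le (k := k) hN
  have hσ : 0 ≤ √N * Real.sin (2 * binomAngle N k) :=
    mul_nonneg (Real.sqrt_nonneg _) sin_two_mul_binomAngle_nonneg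
  have ha1 : (1 : ℝ) ≤ cellIndex N k := by exact_mod_cast one_le_cellIndex
  have hφ0 : 0 < (cellIndex N k : ℝ) / √N := by positivity
  have hφ1 : (cellIndex N k : ℝ) / √N < Real.pi / 2 := by
    rw [div_lt_iff₀ hs]
    linarith [cellIndex_add_half_le (k := k) hN]
  have hS : cellScale N (cellIndex N k) = √N * Real.sin (2 * (cellIndex N k / √N)) := rfl
  generalize cellScale N (cellIndex N k) = S at *
  generalize (cellIndex N k : ℝ) / √N = φ at *
  have hsφ : 0 < Real.sin φ := Real.sin_pos_of_pos_of_lt_pi hφ0 (by linarith)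
  have hcφ : 0 < Real.cos φ := Real.cos_pos_of_mem_Ioo ⟨by linarith, hφ1⟩
  have hexp := binomSin_binomAngle_le_mul_exp hN hk hsφ hcφ
  have hle : (N : ℝ) * ((Real.sin (binomAngle N k) ^ 2 - Real.sin φ ^ 2) ^ 2 /
      (Real.sin φ ^ 2 * Real.cos φ ^ 2)) ≤ 400 := by
    rw [← mul_div_assoc, div_le_iff₀ (by positivity)]
    have h1 := sq_le_sq' (by linarith [(abs_le.1 hdist).1]) (abs_le.1 hdist).2
    have h2 : S ^ 2 = N * (4 * (Real.sin φ ^ 2 * Real.cos φ ^ 2)) := by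
      rw [hS, mul_pow, Real.sq_sqrt hN'.le, Real.sin_two_mul]; ring
    rw [mul_pow, mul_pow, h2] at h1
    refine le_of_mul_le_mul_left ?_ hN'
    linarith
  have hB := binomSin_nonneg (N := N) (k := k) φ
  have hexp' := hexp.trans (mul_le_mul_of_nonneg_left (Real.exp_le_exp.2 hle) hB)
  have h5 : 1 + √N * Real.sin (2 * binomAngle N k) ≤ 66 * (cell N k).card := by linarith
  have h6 := mul_le_mul hexp' h5 (by linarith) (by positivity)
  linarith

lemma exists_sum_one_div_one_add_sq_le :
    ∃ T : ℝ, ∀ K m : ℕ,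
      ∑ a ∈ Finset.range K, 1 / (1 + ((a : ℝ) - m) ^ 2) ≤ T := by
  have hf : Summable fun n : ℤ => 1 / (1 + (n : ℝ) ^ 2) := by
    refine Summable.of_nonneg_of_le (fun n => by positivity) (fun n => ?_)
      ((Real.summable_one_div_int_pow.2 one_lt_two).add
        (hasSum_ite_eq (0 : ℤ) (1 : ℝ)).summable)
    by_cases hn : n = 0
    · simp [hn]
    · have : (0 : ℝ) < (n : ℝ) ^ 2 := by positivity
      simp only [hn, if_false, add_zero]
      gcongr
      linarith
  refine ⟨∑' n : ℤ, 1 / (1 + (n : ℝ) ^ 2), fun K m => ?_⟩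
  refine le_trans (le_of_eq ?_) (hf.sum_le_tsum
    ((Finset.range K).image fun a : ℕ => (a : ℤ) - m) fun n _ => by positivity)
  rw [Finset.sum_image fun a _ b _ h => by simpa using h]
  simp

lemma ofReal_binomSin (N k : ℕ) (φ : ℝ) :
    (N.choose k : ℝ≥0∞) * ENNReal.ofReal (Real.sin φ ^ 2) ^ k *
      (1 - ENNReal.ofReal (Real.sin φ ^ 2)) ^ (N - k) = ENNReal.ofReal (binomSin N k φ) := by
  rw [← ENNReal.ofReal_one, ← ENNReal.ofReal_sub _ (sq_nonneg _), ← Real.cos_sq',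
    binomSin, ENNReal.ofReal_mul (Nat.cast_nonneg _), ENNReal.ofReal_mul (by positivity),
    ENNReal.ofReal_natCast, ENNReal.ofReal_pow (sq_nonneg _), ENNReal.ofReal_pow (sq_nonneg _),
    mul_assoc]

lemma exists_ofReal_sin_sq_eq {p : ℝ≥0∞} (hp : p ≤ 1) :
    ∃ φ : ℝ, 0 ≤ φ ∧ φ ≤ Real.pi / 2 ∧ p = ENNReal.ofReal (Real.sin φ ^ 2) := by
  have h1 : p.toReal ≤ 1 := ENNReal.toReal_le_of_le_ofReal zero_le_one (by simpa using hp)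
  have h2 := Real.sqrt_nonneg p.toReal
  refine ⟨Real.arcsin √p.toReal, Real.arcsin_nonneg.2 h2, Real.arcsin_le_pi_div_two _, ?_⟩
  rw [Real.sin_arcsin (by linarith) (Real.sqrt_le_one.2 h1), Real.sq_sqrt ENNReal.toReal_nonneg,
    ENNReal.ofReal_toReal (hp.trans_lt ENNReal.one_lt_top).ne]

lemma ofReal_binomSin_le_of_card_mul_le {C : ℝ} (hN : 1 ≤ N) (hk : k ≤ N) {φ : ℝ}
    (h : (cell N k).card * binomSin N k φ ≤ C) :
    ENNReal.ofReal (binomSin N k φ) ≤ ENNReal.ofReal C * ((cell N k).card : ℝ≥0∞)⁻¹ := by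
  have hpos : 0 < (cell N k).card :=
    Finset.card_pos.2 ⟨k, (mem_cell_iff hN hk).2 ⟨hk, rfl⟩⟩
  rw [← div_eq_mul_inv, ENNReal.le_div_iff_mul_le (by simp [hpos.ne']) (by simp), mul_comm,
    ← ENNReal.ofReal_natCast, ← ENNReal.ofReal_mul (Nat.cast_nonneg _)]
  exact ENNReal.ofReal_le_ofReal h

lemma sum_ofReal_binomSin_mul_le {T : ℝ}
    (hT : ∀ K m : ℕ, ∑ a ∈ Finset.range K, 1 / (1 + ((a : ℝ) - m) ^ 2) ≤ T)
    (hN : 1 ≤ N) {h : ℕ → ℝ≥0∞} (hh : sinE N h) {φ : ℝ} (h0 : 0 ≤ φ) (h1 : φ ≤ Real.pi / 2) :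
    ∑ k ∈ Finset.range (N + 1), ENNReal.ofReal (binomSin N k φ) * h k ≤
      ENNReal.ofReal (76032 * T) := by
  set g : ℕ → ℝ := fun a => 76032 * (1 / (1 + ((a : ℝ) - ⌊√N * φ⌋₊) ^ 2)) with hg
  have hg0 : ∀ a, 0 ≤ g a := fun a => by positivity
  have hmaps : ∀ k ∈ Finset.range (N + 1),
      cellIndex N k ∈ Finset.range (Nstar N + 2) := by
    intro k _
    rw [Finset.mem_range]
    unfold cellIndex
    omega
  calc ∑ k ∈ Finset.range (N + 1), ENNReal.ofReal (binomSin N k φ) * h k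
      ≤ ∑ k ∈ Finset.range (N + 1),
          ENNReal.ofReal (g (cellIndex N k)) * ((cell N k).card : ℝ≥0∞)⁻¹ * h k := by
        refine Finset.sum_le_sum fun k hk => ?_
        have hk' : k ≤ N := Nat.lt_succ_iff.1 (Finset.mem_range.1 hk)
        gcongr
        exact ofReal_binomSin_le_of_card_mul_le hN hk' (card_mul_binomSin_le hN hk' h0 h1)
    _ = ∑ a ∈ Finset.range (Nstar N + 2), ∑ k ∈ Finset.range (N + 1) with cellIndex N k = a,
          ENNReal.ofReal (g (cellIndex N k)) * ((cell N k).card : ℝ≥0∞)⁻¹ * h k :=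
        (Finset.sum_fiberwise_of_maps_to hmaps _).symm
    _ ≤ ∑ a ∈ Finset.range (Nstar N + 2), ENNReal.ofReal (g a) := by
        refine Finset.sum_le_sum fun a _ => ?_
        rcases (Finset.range (N + 1) |>.filter fun k => cellIndex N k = a).eq_empty_or_nonempty
          with he | ⟨k, hk⟩
        · simp [he]
        obtain ⟨hkN, rfl⟩ := Finset.mem_filter.1 hk
        have hk' : k ≤ N := Nat.lt_succ_iff.1 (Finset.mem_range.1 hkN)
        have hcell : (Finset.range (N + 1)).filter (fun j => cellIndex N j = cellIndex N k) =
            cell N k := by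
          ext j
          rw [Finset.mem_filter, Finset.mem_range, Nat.lt_succ_iff, mem_cell_iff hN hk']
        rw [hcell]
        calc ∑ j ∈ cell N k,
              ENNReal.ofReal (g (cellIndex N j)) * ((cell N j).card : ℝ≥0∞)⁻¹ * h j
            = ∑ j ∈ cell N k,
              ENNReal.ofReal (g (cellIndex N k)) * (((cell N k).card : ℝ≥0∞)⁻¹ * h j) := by
              refine Finset.sum_congr rfl fun j hj => ?_
              obtain ⟨hjN, hj⟩ := (mem_cell_iff hN hk').1 hj
              have : cell N j = cell N k := by
                ext i
                rw [mem_cell_iff hN hjN, mem_cell_iff hN hk', hj]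
              rw [hj, this, mul_assoc]
          _ = ENNReal.ofReal (g (cellIndex N k)) *
              (((cell N k).card : ℝ≥0∞)⁻¹ * ∑ j ∈ cell N k, h j) := by
              rw [← Finset.mul_sum, ← Finset.mul_sum]
          _ ≤ _ := mul_le_of_le_one_right' (hh k hk')
    _ = ENNReal.ofReal (∑ a ∈ Finset.range (Nstar N + 2), g a) :=
        (ENNReal.ofReal_sum_of_nonneg fun a _ => hg0 a).symm
    _ ≤ _ := by
        refine ENNReal.ofReal_le_ofReal ?_
        rw [hg, ← Finset.mul_sum]
        exact mul_le_mul_of_nonneg_left (hT _ _) (by norm_num)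

lemma card_inv_mul_sum_cell_le (hN : 1 ≤ N) {h : ℕ → ℝ≥0∞} (hh : binE N h) (hk : k ≤ N) :
    ((cell N k).card : ℝ≥0∞)⁻¹ * ∑ j ∈ cell N k, h j ≤
      ENNReal.ofReal (264 * Real.exp 400) := by
  set φ := (cellIndex N k : ℝ) / √N with hφ
  set C := 264 * Real.exp 400 with hC
  have hC0 : 0 ≤ C := by positivity
  have hpos : 0 < (cell N k).card :=
    Finset.card_pos.2 ⟨k, (mem_cell_iff hN hk).2 ⟨hk, rfl⟩⟩
  have hsum := hh (ENNReal.ofReal (Real.sin φ ^ 2))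
    (ENNReal.ofReal_le_one.2 (Real.sin_sq_le_one φ))
  simp only [ofReal_binomSin] at hsum
  calc ((cell N k).card : ℝ≥0∞)⁻¹ * ∑ j ∈ cell N k, h j
      = ∑ j ∈ cell N k, ((cell N k).card : ℝ≥0∞)⁻¹ * h j := Finset.mul_sum _ _ _
    _ ≤ ∑ j ∈ cell N k, ENNReal.ofReal C * (ENNReal.ofReal (binomSin N j φ) * h j) := by
        refine Finset.sum_le_sum fun j hj => ?_
        obtain ⟨hjN, hj⟩ := (mem_cell_iff hN hk).1 hj
        have hcell : cell N j = cell N k := by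
          ext i
          rw [mem_cell_iff hN hjN, mem_cell_iff hN hk, hj]
        have hb := one_le_mul_card_mul_binomSin hN hjN
        rw [hj, hcell, ← hφ, ← hC] at hb
        rw [← mul_assoc]
        gcongr
        rw [ENNReal.inv_le_iff_le_mul (fun _ => by exact_mod_cast hpos.ne') (by simp),
          ← ENNReal.ofReal_mul hC0, ← ENNReal.ofReal_natCast, ← ENNReal.ofReal_mul (Nat.cast_nonneg _),
          ENNReal.one_le_ofReal]
        linarith
    _ = ENNReal.ofReal C * ∑ j ∈ cell N k, ENNReal.ofReal (binomSin N j φ) * h j :=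
        (Finset.mul_sum _ _ _).symm
    _ ≤ ENNReal.ofReal C * ∑ j ∈ Finset.range (N + 1),
          ENNReal.ofReal (binomSin N j φ) * h j := by
        gcongr
        exact Finset.filter_subset _ _
    _ ≤ ENNReal.ofReal C := mul_le_of_le_one_right' hsum

end angle

/-- there is a universal constant `c > 0` such that for every
`N ≥ 1`: (a) for every sin-e-function `h`, `c⁻¹·h` is a binomial e-function;
(b) for every binomial e-function `h`, `c⁻¹·h` is a sin-e-function. -/
theorem stmt16 :
    ∃ c : ℝ, 0 < c ∧ ∀ N : ℕ, 1 ≤ N →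
      (∀ h : ℕ → ℝ≥0∞, sinE N h → binE N fun k => (ENNReal.ofReal c)⁻¹ * h k) ∧
      (∀ h : ℕ → ℝ≥0∞, binE N h → sinE N fun k => (ENNReal.ofReal c)⁻¹ * h k) := by
  obtain ⟨T, hT⟩ := exists_sum_one_div_one_add_sq_le
  set c := max (76032 * T) (264 * Real.exp 400)
  have hc0 : 0 < c := lt_max_of_lt_right (by positivity)
  have hdiv : ∀ {s : ℝ≥0∞} {C : ℝ}, s ≤ ENNReal.ofReal C → C ≤ c →
      (ENNReal.ofReal c)⁻¹ * s ≤ 1 := by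
    intro s C hs hC
    rw [mul_comm, ← div_eq_mul_inv]
    exact ENNReal.div_le_of_le_mul (by
      rw [one_mul]; exact hs.trans (ENNReal.ofReal_le_ofReal hC))
  refine ⟨c, hc0, fun N hN => ⟨fun h hh p hp => ?_, fun h hh k hk => ?_⟩⟩
  · obtain ⟨φ, h0, h1, rfl⟩ := exists_ofReal_sin_sq_eq hp
    simp only [ofReal_binomSin, mul_left_comm _ (ENNReal.ofReal c)⁻¹]
    rw [← Finset.mul_sum]
    exact hdiv (sum_ofReal_binomSin_mul_le hT hN hh h0 h1) (le_max_left _ _)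
  · rw [← Finset.mul_sum, mul_left_comm]
    exact hdiv (card_inv_mul_sum_cell_le hN hh hk) (le_max_right _ _)
end
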